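/- arXiv:2202.08527 — 2 statements merged into one kernel-verified Lean document; each statement's English description precedes it below -/
import Mathlib

section
/- Let δ: X → Y, δ′: X′ → Y′ be chain maps of cochain complexes in an additive category, let γ: X → X′ and ω: Y → Y′ be chain maps that are homotopy equivalences, and let F = (Fⁿ: Xⁿ → (Y′)^{n−1}) satisfy d∘F + F∘d = δ′∘γ + ω∘δ. Then the chain map Cone(δ) → Cone(δ′) given degreewise by (y, x) ↦ (−ω y − F x, γ x) is a homotopy equivalence. (This underlies the Reidemeister III chain homotopy equivalences R3 between Khovanov complexes obtained via the Kauffman trick.) -/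
open CategoryTheory CategoryTheory.Limits

set_option linter.unusedSectionVars false

/-- A cochain complex indexed by `ℤ` in an additive category `C`;
`d` denotes the differential. -/
structure Cplx (C : Type*) [Category C] [Preadditive C] where
  X : ℤ → C
  d : ∀ n : ℤ, X n ⟶ X (n + 1)
  dd : ∀ n : ℤ, d n ≫ d (n + 1) = 0

variable {C : Type*} [Category C] [Preadditive C] [HasBinaryBiproducts C]

/-- A degreewise family of morphisms `φⁿ : Aⁿ ⟶ Bⁿ` is a chain map:
`d ∘ φ = φ ∘ d` in every degree. -/
def IsChainMap (A B : Cplx C) (φ : ∀ n : ℤ, A.X n ⟶ B.X n) : Prop :=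
  ∀ n : ℤ, A.d n ≫ φ (n + 1) = φ n ≫ B.d n

@[simp]
theorem dd_assoc (A : Cplx C) (n : ℤ) {Z : C} (f : A.X (n + 1 + 1) ⟶ Z) :
    A.d n ≫ A.d (n + 1) ≫ f = 0 := by
  rw [← Category.assoc, A.dd, zero_comp]

/-- The mapping cone of a chain map `δ : X₀ → Y₀`:
`Cone(δ)ⁿ = Y₀ⁿ ⊕ X₀ⁿ⁺¹`, with differential `(y, x) ↦ (d y + δ x, −d x)`. -/
noncomputable def MCone (X₀ Y₀ : Cplx C) (δ : ∀ n : ℤ, X₀.X n ⟶ Y₀.X n)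
    (hδ : IsChainMap X₀ Y₀ δ) : Cplx C where
  X n := Y₀.X n ⊞ X₀.X (n + 1)
  d n := biprod.desc (biprod.lift (Y₀.d n) 0) (biprod.lift (δ (n + 1)) (-(X₀.d (n + 1))))
  dd n := by
    apply biprod.hom_ext' <;> apply biprod.hom_ext <;>
      simp [Y₀.dd, X₀.dd, hδ (n + 1)]

/-- Two degreewise families of morphisms are chain homotopic: there is a family
`hⁿ : Aⁿ ⟶ Bⁿ⁻¹` with `d ∘ h + h ∘ d = φ − ψ` in every degree. -/
def Homotopic (A B : Cplx C) (φ ψ : ∀ n : ℤ, A.X n ⟶ B.X n) : Prop :=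
  ∃ h : ∀ n : ℤ, A.X (n + 1) ⟶ B.X n,
    ∀ n : ℤ, h n ≫ B.d n + A.d (n + 1) ≫ h (n + 1) = φ (n + 1) - ψ (n + 1)

/-- A degreewise family of morphisms is a chain homotopy equivalence:
it is a chain map admitting a two-sided inverse up to homotopy. -/
def IsHtpyEquiv (A B : Cplx C) (φ : ∀ n : ℤ, A.X n ⟶ B.X n) : Prop :=
  IsChainMap A B φ ∧ ∃ ψ : ∀ n : ℤ, B.X n ⟶ A.X n, IsChainMap B A ψ ∧
    Homotopic A A (fun n => φ n ≫ ψ n) (fun n => 𝟙 (A.X n)) ∧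
    Homotopic B B (fun n => ψ n ≫ φ n) (fun n => 𝟙 (B.X n))

/-- A degreewise family of morphisms is an isomorphism of cochain complexes. -/
def IsCplxIso (A B : Cplx C) (φ : ∀ n : ℤ, A.X n ⟶ B.X n) : Prop :=
  IsChainMap A B φ ∧ ∃ ψ : ∀ n : ℤ, B.X n ⟶ A.X n, IsChainMap B A ψ ∧
    (∀ n : ℤ, φ n ≫ ψ n = 𝟙 (A.X n)) ∧ (∀ n : ℤ, ψ n ≫ φ n = 𝟙 (B.X n))

/-- Two cochain complexes are isomorphic. -/
def CplxIsomorphic (A B : Cplx C) : Prop := ∃ φ, IsCplxIso A B φ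

/-- Two cochain complexes are chain homotopy equivalent. -/
def HtpyEquivalent (A B : Cplx C) : Prop := ∃ φ, IsHtpyEquiv A B φ

theorem IsChainMap.comp {A B D : Cplx C} {φ : ∀ n : ℤ, A.X n ⟶ B.X n}
    {ψ : ∀ n : ℤ, B.X n ⟶ D.X n} (hφ : IsChainMap A B φ) (hψ : IsChainMap B D ψ) :
    IsChainMap A D (fun n => φ n ≫ ψ n) := fun n => by
  rw [← Category.assoc, hφ, Category.assoc, hψ, Category.assoc]

theorem Homotopic.symm {A B : Cplx C} {φ ψ : ∀ n : ℤ, A.X n ⟶ B.X n}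
    (H : Homotopic A B φ ψ) : Homotopic A B ψ φ := by
  obtain ⟨h, hh⟩ := H
  refine ⟨fun n => -h n, fun n => ?_⟩
  rw [← neg_sub, ← hh]
  simp only [Preadditive.neg_comp, Preadditive.comp_neg]
  abel

theorem Homotopic.trans {A B : Cplx C} {φ ψ χ : ∀ n : ℤ, A.X n ⟶ B.X n}
    (H : Homotopic A B φ ψ) (H' : Homotopic A B ψ χ) : Homotopic A B φ χ := by
  obtain ⟨h, hh⟩ := H
  obtain ⟨h', hh'⟩ := H'
  refine ⟨fun n => h n + h' n, fun n => ?_⟩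
  rw [← sub_add_sub_cancel (φ (n + 1)) (ψ (n + 1)), ← hh, ← hh']
  simp only [Preadditive.add_comp, Preadditive.comp_add]
  abel

theorem Homotopic.comp_left {A B D : Cplx C} {α : ∀ n : ℤ, A.X n ⟶ B.X n}
    (hα : IsChainMap A B α) {φ ψ : ∀ n : ℤ, B.X n ⟶ D.X n} (H : Homotopic B D φ ψ) :
    Homotopic A D (fun n => α n ≫ φ n) (fun n => α n ≫ ψ n) := by
  obtain ⟨h, hh⟩ := H
  refine ⟨fun n => α (n + 1) ≫ h n, fun n => ?_⟩
  rw [← Preadditive.comp_sub, ← hh, ← Category.assoc (A.d _), hα]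
  simp

theorem Homotopic.comp_right {A B D : Cplx C} {φ ψ : ∀ n : ℤ, A.X n ⟶ B.X n}
    (H : Homotopic A B φ ψ) {α : ∀ n : ℤ, B.X n ⟶ D.X n} (hα : IsChainMap B D α) :
    Homotopic A D (fun n => φ n ≫ α n) (fun n => ψ n ≫ α n) := by
  obtain ⟨h, hh⟩ := H
  refine ⟨fun n => h n ≫ α n, fun n => ?_⟩
  rw [← Preadditive.sub_comp, ← hh, Category.assoc, ← hα]
  simp

/-- A chain map with a homotopy retraction, which itself has a homotopy retraction, is a
homotopy equivalence. -/
theorem isHtpyEquiv_of_retractions {A B : Cplx C} {φ χ : ∀ n : ℤ, A.X n ⟶ B.X n}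
    {ψ : ∀ n : ℤ, B.X n ⟶ A.X n} (hφ : IsChainMap A B φ) (hψ : IsChainMap B A ψ)
    (hχ : IsChainMap A B χ)
    (hφψ : Homotopic A A (fun n => φ n ≫ ψ n) (fun n => 𝟙 (A.X n)))
    (hψχ : Homotopic B B (fun n => ψ n ≫ χ n) (fun n => 𝟙 (B.X n))) :
    IsHtpyEquiv A B φ := by
  have h₁ : Homotopic A B χ φ := by
    have h := (hφψ.comp_right hχ).symm.trans
      (by simpa only [Category.assoc] using hψχ.comp_left hφ)
    simpa only [Category.id_comp, Category.comp_id] using h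
  exact ⟨hφ, ψ, hψ, hφψ, (h₁.comp_left hψ).symm.trans hψχ⟩

theorem IsHtpyEquiv.exists_inverse {A B : Cplx C} {φ : ∀ n : ℤ, A.X n ⟶ B.X n}
    (h : IsHtpyEquiv A B φ) : ∃ ψ, IsHtpyEquiv B A ψ ∧
      Homotopic A A (fun n => φ n ≫ ψ n) (fun n => 𝟙 (A.X n)) ∧
      Homotopic B B (fun n => ψ n ≫ φ n) (fun n => 𝟙 (B.X n)) := by
  obtain ⟨hφ, ψ, hψ, h₁, h₂⟩ := h
  exact ⟨ψ, ⟨hψ, φ, hφ, h₂, h₁⟩, h₁, h₂⟩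

/-- The differential `d ∘ E + E ∘ d` of a family `Eⁿ⁺¹ : Aⁿ⁺¹ ⟶ Bⁿ` of degree `-1`. -/
def boundary (A B : Cplx C) (E : ∀ n : ℤ, A.X (n + 1) ⟶ B.X n) (n : ℤ) :
    A.X (n + 1) ⟶ B.X (n + 1) :=
  E n ≫ B.d n + A.d (n + 1) ≫ E (n + 1)

theorem boundary_add (A B : Cplx C) (E E' : ∀ n : ℤ, A.X (n + 1) ⟶ B.X n) (n : ℤ) :
    boundary A B (fun n => E n + E' n) n = boundary A B E n + boundary A B E' n := by
  simp only [boundary, Preadditive.add_comp, Preadditive.comp_add]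
  abel

theorem boundary_sub (A B : Cplx C) (E E' : ∀ n : ℤ, A.X (n + 1) ⟶ B.X n) (n : ℤ) :
    boundary A B (fun n => E n - E' n) n = boundary A B E n - boundary A B E' n := by
  simp only [boundary, Preadditive.sub_comp, Preadditive.comp_sub]
  abel

theorem boundary_comp_left {A B D : Cplx C} {α : ∀ n : ℤ, A.X n ⟶ B.X n}
    (hα : IsChainMap A B α) (E : ∀ n : ℤ, B.X (n + 1) ⟶ D.X n) (n : ℤ) :
    boundary A D (fun n => α (n + 1) ≫ E n) n = α (n + 1) ≫ boundary B D E n := by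
  simp only [boundary, Preadditive.comp_add, Category.assoc]
  rw [← Category.assoc (A.d _), hα, Category.assoc]

theorem boundary_comp_right {A B D : Cplx C} (E : ∀ n : ℤ, A.X (n + 1) ⟶ B.X n)
    {α : ∀ n : ℤ, B.X n ⟶ D.X n} (hα : IsChainMap B D α) (n : ℤ) :
    boundary A D (fun n => E n ≫ α n) n = boundary A B E n ≫ α (n + 1) := by
  simp only [boundary, Preadditive.add_comp, Category.assoc]
  rw [hα]

/-- The degreewise family `(y, x) ↦ (−ω y − F x, γ x)` between mapping cones. -/
noncomputable def coneMatrix {X X' Y Y' : Cplx C} (γ : ∀ n : ℤ, X.X n ⟶ X'.X n)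
    (ω : ∀ n : ℤ, Y.X n ⟶ Y'.X n) (F : ∀ n : ℤ, X.X (n + 1) ⟶ Y'.X n) (n : ℤ) :
    Y.X n ⊞ X.X (n + 1) ⟶ Y'.X n ⊞ X'.X (n + 1) :=
  biprod.desc (biprod.lift (-(ω n)) 0) (biprod.lift (-(F n)) (γ (n + 1)))

theorem isChainMap_coneMatrix {X X' Y Y' : Cplx C}
    {δ : ∀ n : ℤ, X.X n ⟶ Y.X n} (hδ : IsChainMap X Y δ)
    {δ' : ∀ n : ℤ, X'.X n ⟶ Y'.X n} (hδ' : IsChainMap X' Y' δ')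
    {γ : ∀ n : ℤ, X.X n ⟶ X'.X n} (hγ : IsChainMap X X' γ)
    {ω : ∀ n : ℤ, Y.X n ⟶ Y'.X n} (hω : IsChainMap Y Y' ω)
    {F : ∀ n : ℤ, X.X (n + 1) ⟶ Y'.X n}
    (hF : ∀ n : ℤ, boundary X Y' F n = γ (n + 1) ≫ δ' (n + 1) + δ (n + 1) ≫ ω (n + 1)) :
    IsChainMap (MCone X Y δ hδ) (MCone X' Y' δ' hδ') (coneMatrix γ ω F) := by
  intro n
  have h := hF n
  simp only [boundary] at h
  apply biprod.hom_ext' <;> apply biprod.hom_ext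
  · simp [MCone, coneMatrix, hω n]
  · simp [MCone, coneMatrix]
  · simp [MCone, coneMatrix]
    grind
  · simp [MCone, coneMatrix, hγ (n + 1)]

theorem exists_retraction_coneMatrix {X X' Y Y' : Cplx C}
    {δ : ∀ n : ℤ, X.X n ⟶ Y.X n} (hδ : IsChainMap X Y δ)
    {δ' : ∀ n : ℤ, X'.X n ⟶ Y'.X n} (hδ' : IsChainMap X' Y' δ')
    {γ : ∀ n : ℤ, X.X n ⟶ X'.X n} (hγ : IsChainMap X X' γ)
    {γ' : ∀ n : ℤ, X'.X n ⟶ X.X n} (hγ' : IsChainMap X' X γ')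
    {ω : ∀ n : ℤ, Y.X n ⟶ Y'.X n} {ω' : ∀ n : ℤ, Y'.X n ⟶ Y.X n} (hω' : IsChainMap Y' Y ω')
    (hγγ' : Homotopic X X (fun n => γ n ≫ γ' n) (fun n => 𝟙 (X.X n)))
    (hγ'γ : Homotopic X' X' (fun n => γ' n ≫ γ n) (fun n => 𝟙 (X'.X n)))
    (hωω' : Homotopic Y Y (fun n => ω n ≫ ω' n) (fun n => 𝟙 (Y.X n)))
    {F : ∀ n : ℤ, X.X (n + 1) ⟶ Y'.X n}
    (hF : ∀ n : ℤ, boundary X Y' F n = γ (n + 1) ≫ δ' (n + 1) + δ (n + 1) ≫ ω (n + 1)) :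
    ∃ G : ∀ n : ℤ, X'.X (n + 1) ⟶ Y.X n,
      (∀ n : ℤ, boundary X' Y G n = γ' (n + 1) ≫ δ (n + 1) + δ' (n + 1) ≫ ω' (n + 1)) ∧
      Homotopic (MCone X Y δ hδ) (MCone X Y δ hδ)
        (fun n => coneMatrix γ ω F n ≫ coneMatrix γ' ω' G n)
        (fun n => 𝟙 ((MCone X Y δ hδ).X n)) := by
  obtain ⟨k, hk⟩ := hγγ'
  obtain ⟨k', hk'⟩ := hγ'γ
  obtain ⟨h, hh⟩ := hωω'
  change ∀ n, boundary X X k n = _ at hk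
  change ∀ n, boundary X' X' k' n = _ at hk'
  change ∀ n, boundary Y Y h n = _ at hh
  let G : ∀ n : ℤ, X'.X (n + 1) ⟶ Y.X n := fun n =>
    γ' (n + 1) ≫ F n ≫ ω' n - k' n ≫ δ' n ≫ ω' n - γ' (n + 1) ≫ δ (n + 1) ≫ h n
  have hG (n : ℤ) : boundary X' Y G n =
      γ' (n + 1) ≫ δ (n + 1) + δ' (n + 1) ≫ ω' (n + 1) := by
    rw [boundary_sub, boundary_sub, boundary_comp_left hγ' (fun n => F n ≫ ω' n),
      boundary_comp_right F hω', boundary_comp_right k' (hδ'.comp hω'),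
      boundary_comp_left hγ' (fun n => δ (n + 1) ≫ h n), boundary_comp_left hδ, hF, hk', hh]
    simp only [Preadditive.add_comp, Preadditive.comp_add, Preadditive.sub_comp,
      Preadditive.comp_sub, Category.assoc, Category.id_comp, Category.comp_id]
    abel
  let N : ∀ n : ℤ, X.X (n + 1) ⟶ Y.X n := fun n =>
    F n ≫ ω' n - γ (n + 1) ≫ G n + k n ≫ δ n - δ (n + 1) ≫ h n
  have hN (n : ℤ) : boundary X Y N n = 0 := by
    rw [boundary_sub, boundary_add, boundary_sub, boundary_comp_right F hω',
      boundary_comp_left hγ, boundary_comp_right k hδ, boundary_comp_left hδ, hF, hG, hk, hh]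
    simp only [Preadditive.add_comp, Preadditive.comp_add, Preadditive.sub_comp,
      Preadditive.comp_sub, Category.assoc, Category.id_comp, Category.comp_id]
    abel
  refine ⟨fun n => G n + γ' (n + 1) ≫ N n, fun n => ?_, fun n =>
    biprod.desc (biprod.lift (h n) 0) (biprod.lift (k (n + 1) ≫ N n) (-(k (n + 1)))),
    fun n => ?_⟩
  · rw [boundary_add, boundary_comp_left hγ', hN, hG, comp_zero, add_zero]
  have hNdef : N (n + 1) = F (n + 1) ≫ ω' (n + 1) - γ (n + 1 + 1) ≫ G (n + 1) +
    k (n + 1) ≫ δ (n + 1) - δ (n + 1 + 1) ≫ h (n + 1) := rfl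
  clear_value N G
  have hNn := congrArg (k (n + 1) ≫ ·) (hN n)
  have hkN := congrArg (· ≫ N (n + 1)) (hk (n + 1))
  have hkn := hk (n + 1)
  have hhn := hh n
  simp only [boundary, Preadditive.add_comp, Preadditive.comp_add, Preadditive.sub_comp,
      Category.assoc, Category.id_comp, comp_zero] at hNn hkN hkn hhn
  let P (m : ℤ) : C := Y.X m ⊞ X.X (m + 1)
  change (_ : P (n + 1) ⟶ P n) ≫ (_ : P n ⟶ P (n + 1)) +
    (_ : P (n + 1) ⟶ P (n + 1 + 1)) ≫ (_ : P (n + 1 + 1) ⟶ P (n + 1)) =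
    coneMatrix γ ω F (n + 1) ≫ coneMatrix γ' ω' _ (n + 1) - 𝟙 (Y.X (n + 1) ⊞ X.X (n + 1 + 1))
  dsimp only [P]
  apply biprod.hom_ext' <;> apply biprod.hom_ext
  · simp [MCone, coneMatrix, hhn]
  · simp [MCone, coneMatrix]
  · simp [MCone, coneMatrix]
    grind
  · simp [MCone, coneMatrix, hkn]

/-- If `γ` and `ω` are chain maps which are homotopy equivalences and the
family `F` satisfies `d∘F + F∘d = δ′∘γ + ω∘δ`, then the chain map `Cone(δ) → Cone(δ′)` given
degreewise by `(y, x) ↦ (−ω y − F x, γ x)` is a homotopy equivalence. -/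
theorem cone_matrix_isHtpyEquiv (X X' Y Y' : Cplx C)
    (δ : ∀ n : ℤ, X.X n ⟶ Y.X n) (hδ : IsChainMap X Y δ)
    (δ' : ∀ n : ℤ, X'.X n ⟶ Y'.X n) (hδ' : IsChainMap X' Y' δ')
    (γ : ∀ n : ℤ, X.X n ⟶ X'.X n) (hγ : IsHtpyEquiv X X' γ)
    (ω : ∀ n : ℤ, Y.X n ⟶ Y'.X n) (hω : IsHtpyEquiv Y Y' ω)
    (F : ∀ n : ℤ, X.X (n + 1) ⟶ Y'.X n)
    (hF : ∀ n : ℤ, F n ≫ Y'.d n + X.d (n + 1) ≫ F (n + 1) =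
      γ (n + 1) ≫ δ' (n + 1) + δ (n + 1) ≫ ω (n + 1)) :
    IsHtpyEquiv (MCone X Y δ hδ) (MCone X' Y' δ' hδ')
      (fun n => biprod.desc (biprod.lift (-(ω n)) 0) (biprod.lift (-(F n)) (γ (n + 1)))) := by
  obtain ⟨γ', hγ', hγγ', hγ'γ⟩ := hγ.exists_inverse
  obtain ⟨ω', hω', hωω', hω'ω⟩ := hω.exists_inverse
  obtain ⟨G, hG, hFG⟩ :=
    exists_retraction_coneMatrix hδ hδ' hγ.1 hγ'.1 hω'.1 hγγ' hγ'γ hωω' hF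
  obtain ⟨F', hF', hGF'⟩ :=
    exists_retraction_coneMatrix hδ' hδ hγ'.1 hγ.1 hω.1 hγ'γ hγγ' hω'ω hG
  exact isHtpyEquiv_of_retractions (isChainMap_coneMatrix hδ hδ' hγ.1 hω.1 hF)
    (isChainMap_coneMatrix hδ' hδ hγ'.1 hω'.1 hG)
    (isChainMap_coneMatrix hδ hδ' hγ.1 hω.1 hF') hFG hGF'
end

section
/- Let a: X → Y, b: Z → W, f: X → Z and g: Y → W be chain maps of cochain complexes in an additive category with g∘a = b∘f. Then: (1) the family (y, x) ↦ (g y, f x) is a chain map u: Cone(a) → Cone(b), and the family (z, x) ↦ (b z, a x) is a chain map v: Cone(f) → Cone(g); and (2) the iterated mapping cones Cone(u) and Cone(v) are isomorphic as cochain complexes; explicitly, the degreewise map Cone(u)ⁿ = Wⁿ ⊕ Z^{n+1} ⊕ Y^{n+1} ⊕ X^{n+2} → Cone(v)ⁿ = Wⁿ ⊕ Y^{n+1} ⊕ Z^{n+1} ⊕ X^{n+2}, (w, z, y, x) ↦ (w, y, z, −x), is an isomorphism of cochain complexes. (This is the statement that taking mapping cones of a strictly commutative square in its two different directions yields isomorphic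 total complexes, used in the proof of the categorified 4T relation.) -/
open CategoryTheory CategoryTheory.Limits

set_option linter.unusedSectionVars false

variable {C : Type*} [Category C] [Preadditive C] [HasBinaryBiproducts C]

/-- A strictly commutative square of chain maps (top `t`, bottom `s`, left `l`, right `r`)
induces a chain map of mapping cones, given degreewise by `(q, p) ↦ (r q, l p)`. -/
theorem coneSq_isChainMap {P Q R S : Cplx C}
    {t : ∀ n : ℤ, P.X n ⟶ Q.X n} (ht : IsChainMap P Q t)
    {s : ∀ n : ℤ, R.X n ⟶ S.X n} (hs : IsChainMap R S s)
    {l : ∀ n : ℤ, P.X n ⟶ R.X n} (hl : IsChainMap P R l)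
    {r : ∀ n : ℤ, Q.X n ⟶ S.X n} (hr : IsChainMap Q S r)
    (hcomm : ∀ n : ℤ, t n ≫ r n = l n ≫ s n) :
    IsChainMap (MCone P Q t ht) (MCone R S s hs)
      (fun n => biprod.desc (biprod.lift (r n) 0) (biprod.lift 0 (l (n + 1)))) := by
  intro n
  apply biprod.hom_ext' <;> apply biprod.hom_ext <;>
    simp [MCone, hr n, hl (n + 1), hcomm (n + 1), reassoc_of% hcomm (n + 1)]

/-- The morphism `(w, z, y, x) ↦ (w, y, z, −x)` between iterated biproducts. -/
noncomputable def biprodSwapNeg (W Z Y X : C) :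
    (W ⊞ Z) ⊞ (Y ⊞ X) ⟶ (W ⊞ Y) ⊞ (Z ⊞ X) :=
  biprod.desc
    (biprod.desc (biprod.lift (biprod.lift (𝟙 W) 0) 0) (biprod.lift 0 (biprod.lift (𝟙 Z) 0)))
    (biprod.desc (biprod.lift (biprod.lift 0 (𝟙 Y)) 0) (biprod.lift 0 (biprod.lift 0 (-(𝟙 X)))))

theorem biprodSwapNeg_comp_biprodSwapNeg (W Z Y X : C) :
    biprodSwapNeg W Z Y X ≫ biprodSwapNeg W Y Z X = 𝟙 _ := by
  apply biprod.hom_ext' <;> apply biprod.hom_ext' <;> apply biprod.hom_ext <;>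
    apply biprod.hom_ext <;> simp [biprodSwapNeg]

/-- `biprodSwapNeg` intertwines the differentials of the two iterated cones of a square. -/
theorem biprodSwapNeg_comm {W Z Y X W' Z' Y' X' : C}
    (dW : W ⟶ W') (dZ : Z ⟶ Z') (dY : Y ⟶ Y') (dX : X ⟶ X')
    (a : X ⟶ Y') (b : Z ⟶ W') (f : X ⟶ Z') (g : Y ⟶ W') :
    biprod.desc
        (biprod.lift (biprod.desc (biprod.lift dW 0) (biprod.lift b (-dZ))) 0)
        (biprod.lift (biprod.desc (biprod.lift g 0) (biprod.lift 0 f))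
          (-(biprod.desc (biprod.lift dY 0) (biprod.lift a (-dX))))) ≫
      biprodSwapNeg W' Z' Y' X' =
    biprodSwapNeg W Z Y X ≫
      biprod.desc
        (biprod.lift (biprod.desc (biprod.lift dW 0) (biprod.lift g (-dY))) 0)
        (biprod.lift (biprod.desc (biprod.lift b 0) (biprod.lift 0 a))
          (-(biprod.desc (biprod.lift dZ 0) (biprod.lift f (-dX))))) := by
  apply biprod.hom_ext' <;> apply biprod.hom_ext' <;> apply biprod.hom_ext <;>
    apply biprod.hom_ext <;> simp [biprodSwapNeg]

theorem biprodSwapNeg_isChainMap {X Y Z W : Cplx C}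
    {a : ∀ n : ℤ, X.X n ⟶ Y.X n} (ha : IsChainMap X Y a)
    {b : ∀ n : ℤ, Z.X n ⟶ W.X n} (hb : IsChainMap Z W b)
    {f : ∀ n : ℤ, X.X n ⟶ Z.X n} (hf : IsChainMap X Z f)
    {g : ∀ n : ℤ, Y.X n ⟶ W.X n} (hg : IsChainMap Y W g)
    (hsq : ∀ n : ℤ, a n ≫ g n = f n ≫ b n) :
    IsChainMap
      (MCone (MCone X Y a ha) (MCone Z W b hb)
        (fun n => biprod.desc (biprod.lift (g n) 0) (biprod.lift 0 (f (n + 1))))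
        (coneSq_isChainMap ha hb hf hg hsq))
      (MCone (MCone X Z f hf) (MCone Y W g hg)
        (fun n => biprod.desc (biprod.lift (b n) 0) (biprod.lift 0 (a (n + 1))))
        (coneSq_isChainMap hf hg ha hb (fun n => (hsq n).symm)))
      (fun n => biprodSwapNeg (W.X n) (Z.X (n + 1)) (Y.X (n + 1)) (X.X (n + 1 + 1))) := fun _ =>
  biprodSwapNeg_comm _ _ _ _ _ _ _ _

/-- A strictly commutative square of chain maps `g ∘ a = b ∘ f` induces chain
maps `u : Cone(a) → Cone(b)`, `(y, x) ↦ (g y, f x)`, and `v : Cone(f) → Cone(g)`,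
`(z, x) ↦ (b z, a x)`, and the iterated cones `Cone(u)` and `Cone(v)` are isomorphic via the
degreewise map `(w, z, y, x) ↦ (w, y, z, −x)`. -/
theorem iterated_cones_isomorphic (X Y Z W : Cplx C)
    (a : ∀ n : ℤ, X.X n ⟶ Y.X n) (ha : IsChainMap X Y a)
    (b : ∀ n : ℤ, Z.X n ⟶ W.X n) (hb : IsChainMap Z W b)
    (f : ∀ n : ℤ, X.X n ⟶ Z.X n) (hf : IsChainMap X Z f)
    (g : ∀ n : ℤ, Y.X n ⟶ W.X n) (hg : IsChainMap Y W g)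
    (hsq : ∀ n : ℤ, a n ≫ g n = f n ≫ b n) :
    IsChainMap (MCone X Y a ha) (MCone Z W b hb)
      (fun n => biprod.desc (biprod.lift (g n) 0) (biprod.lift 0 (f (n + 1)))) ∧
    IsChainMap (MCone X Z f hf) (MCone Y W g hg)
      (fun n => biprod.desc (biprod.lift (b n) 0) (biprod.lift 0 (a (n + 1)))) ∧
    IsCplxIso
      (MCone (MCone X Y a ha) (MCone Z W b hb)
        (fun n => biprod.desc (biprod.lift (g n) 0) (biprod.lift 0 (f (n + 1))))
        (coneSq_isChainMap ha hb hf hg hsq))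
      (MCone (MCone X Z f hf) (MCone Y W g hg)
        (fun n => biprod.desc (biprod.lift (b n) 0) (biprod.lift 0 (a (n + 1))))
        (coneSq_isChainMap hf hg ha hb (fun n => (hsq n).symm)))
      (fun n => biprod.desc
        (biprod.desc (biprod.lift (biprod.lift (𝟙 (W.X n)) 0) 0)
          (biprod.lift 0 (biprod.lift (𝟙 (Z.X (n + 1))) 0)))
        (biprod.desc (biprod.lift (biprod.lift 0 (𝟙 (Y.X (n + 1)))) 0)
          (biprod.lift 0 (biprod.lift 0 (-(𝟙 (X.X (n + 1 + 1)))))))) := by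
  exact ⟨coneSq_isChainMap ha hb hf hg hsq,
    coneSq_isChainMap hf hg ha hb (fun n => (hsq n).symm),
    biprodSwapNeg_isChainMap ha hb hf hg hsq,
    fun n => biprodSwapNeg (W.X n) (Y.X (n + 1)) (Z.X (n + 1)) (X.X (n + 1 + 1)),
    biprodSwapNeg_isChainMap hf hg ha hb (fun n => (hsq n).symm),
    fun _ => biprodSwapNeg_comp_biprodSwapNeg _ _ _ _,
    fun _ => biprodSwapNeg_comp_biprodSwapNeg _ _ _ _⟩
end
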